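/- arXiv:1004.5223 — 3 statements merged into one kernel-verified Lean document; each statement's English description precedes it below -/
import Mathlib

section
/- For every ν = (ν₁, ν₂, ν₃) ∈ ℝ³ there exists a matrix R ∈ SO(4) (a real 4×4 orthogonal matrix with determinant 1) such that R · Ω_ν · R⁻¹ = ‖ν‖ · I₀, where ‖ν‖ = √(ν₁² + ν₂² + ν₃²). -/
/-- The matrix `Ω_ν` associated to a uniform magnetic field `ν = (ν₁, ν₂, ν₃) ∈ ℝ³`. -/
def Omega (ν : Fin 3 → ℝ) : Matrix (Fin 4) (Fin 4) ℝ :=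
  !![0,   -ν 0, -ν 1, -ν 2;
     ν 0,  0,   -ν 2,  ν 1;
     ν 1,  ν 2,  0,   -ν 0;
     ν 2, -ν 1,  ν 0,  0]

/-- The standard orthogonal complex structure `I₀` on `ℝ⁴`. -/
def I0 : Matrix (Fin 4) (Fin 4) ℝ :=
  !![0, -1, 0, 0;
     1,  0, 0, 0;
     0,  0, 0, -1;
     0,  0, 1, 0]

/-- Left multiplication by the quaternion `a + b j + c k` on `ℝ⁴`. -/
def quaternionLeftMul (a b c : ℝ) : Matrix (Fin 4) (Fin 4) ℝ :=
  !![a,  0, -b, -c;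
     0,  a, -c,  b;
     b,  c,  a,  0;
     c, -b,  0,  a]

theorem quaternionLeftMul_mem_specialOrthogonalGroup {a b c : ℝ}
    (h : a ^ 2 + b ^ 2 + c ^ 2 = 1) :
    quaternionLeftMul a b c ∈ Matrix.specialOrthogonalGroup (Fin 4) ℝ := by
  rw [Matrix.mem_specialOrthogonalGroup_iff]
  constructor
  · rw [Matrix.mem_orthogonalGroup_iff]
    ext i j
    fin_cases i <;> fin_cases j <;>
      simp [quaternionLeftMul, Matrix.mul_apply, Fin.sum_univ_four] <;> linarith
  · have hdet : (quaternionLeftMul a b c).det = (a ^ 2 + b ^ 2 + c ^ 2) ^ 2 := by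
      simp [quaternionLeftMul, Matrix.det_succ_row_zero, Fin.sum_univ_succ, Fin.succAbove]
      ring
    rw [hdet, h, one_pow]

/-- A unit quaternion `q = a + b j + c k` satisfying `q ν = n i q`, where `ν = x i + y j + z k` and
`n ^ 2 = ‖ν‖ ^ 2`. -/
theorem exists_unit_quaternion_intertwining (x y z n : ℝ)
    (h : n ^ 2 = x ^ 2 + y ^ 2 + z ^ 2) :
    ∃ a b c : ℝ, a ^ 2 + b ^ 2 + c ^ 2 = 1 ∧ b * y + c * z = 0 ∧
      a * x + b * z - c * y = n * a ∧ a * y + c * x = -(n * c) ∧ a * z - b * x = n * b := by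
  by_cases hx : n + x = 0
  · have hxn : x = -n := by linarith
    subst hxn
    have hy : y = 0 := by nlinarith [sq_nonneg y, sq_nonneg z]
    have hz : z = 0 := by nlinarith [sq_nonneg y, sq_nonneg z]
    exact ⟨0, 1, 0, by simp [hy, hz]⟩
  · have hpos : 0 < (n + x) ^ 2 + z ^ 2 + y ^ 2 := by positivity
    set s := √((n + x) ^ 2 + z ^ 2 + y ^ 2)
    have hs0 : s ≠ 0 := (Real.sqrt_pos.2 hpos).ne'
    have hs2 : s ^ 2 = (n + x) ^ 2 + z ^ 2 + y ^ 2 := Real.sq_sqrt hpos.le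
    refine ⟨(n + x) / s, z / s, -y / s, ?_, ?_, ?_, ?_, ?_⟩ <;> field_simp <;> linarith

/-- For every `ν ∈ ℝ³` there is `R ∈ SO(4)` with `R Ω_ν R⁻¹ = ‖ν‖ I₀`. -/
theorem exists_SO4_conj (ν : Fin 3 → ℝ) :
    ∃ R : Matrix (Fin 4) (Fin 4) ℝ, R ∈ Matrix.specialOrthogonalGroup (Fin 4) ℝ ∧
      R * Omega ν * R⁻¹ = Real.sqrt (ν 0 ^ 2 + ν 1 ^ 2 + ν 2 ^ 2) • I0 := by
  obtain ⟨a, b, c, hq, h₀, h₁, h₂, h₃⟩ :=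
    exists_unit_quaternion_intertwining (ν 0) (ν 1) (ν 2) _
      (Real.sq_sqrt (by positivity))
  have hR := quaternionLeftMul_mem_specialOrthogonalGroup hq
  refine ⟨_, hR, ?_⟩
  have hdet : IsUnit (quaternionLeftMul a b c).det := by
    rw [(Matrix.mem_specialOrthogonalGroup_iff.1 hR).2]
    exact isUnit_one
  generalize √(ν 0 ^ 2 + ν 1 ^ 2 + ν 2 ^ 2) = n at *
  have hcomm : quaternionLeftMul a b c * Omega ν = (n • I0) * quaternionLeftMul a b c := by
    ext i j
    fin_cases i <;> fin_cases j <;>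
      simp [quaternionLeftMul, Omega, I0, Matrix.mul_apply, Fin.sum_univ_four] <;> linarith
  rw [hcomm, Matrix.mul_nonsing_inv_cancel_right _ _ hdet]
end

section
/- Let ν = (ν₁, ν₂, ν₃) ∈ ℝ³ with ν₂² + ν₃² ≠ 0, set λ = √(ν₂² + ν₃²) and n = ‖ν‖ = √(ν₁² + ν₂² + ν₃²). Then the 4×4 matrix R with rows (1, 0, 0, 0), (0, ν₁/n, 0, −λ/n), (0, ν₂/n, ν₃/λ, ν₁ν₂/(λn)), (0, ν₃/n, −ν₂/λ, ν₁ν₃/(λn)) is orthogonal with determinant 1, and satisfies R · (n · I₀) · R⁻¹ = Ω_ν (equivalently, R⁻¹ · Ω_ν · R = n · I₀). -/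
/-- The explicit matrix `R` (for `ν₂² + ν₃² ≠ 0`) is special orthogonal and conjugates
`‖ν‖ · I₀` into `Ω_ν`. -/
theorem conj_matrix_explicit (ν : Fin 3 → ℝ) (h : ν 1 ^ 2 + ν 2 ^ 2 ≠ 0) :
    let lam : ℝ := Real.sqrt (ν 1 ^ 2 + ν 2 ^ 2)
    let n : ℝ := Real.sqrt (ν 0 ^ 2 + ν 1 ^ 2 + ν 2 ^ 2)
    let R : Matrix (Fin 4) (Fin 4) ℝ :=
      !![1, 0,       0,         0;
         0, ν 0 / n, 0,         -lam / n;
         0, ν 1 / n, ν 2 / lam, ν 0 * ν 1 / (lam * n);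
         0, ν 2 / n, -ν 1 / lam, ν 0 * ν 2 / (lam * n)]
    R ∈ Matrix.specialOrthogonalGroup (Fin 4) ℝ ∧ R * (n • I0) * R⁻¹ = Omega ν := by
  intro lam n R
  have hlam_sq : lam ^ 2 = ν 1 ^ 2 + ν 2 ^ 2 := Real.sq_sqrt (by positivity)
  have hn_sq : n ^ 2 = ν 0 ^ 2 + lam ^ 2 := by
    rw [hlam_sq, ← add_assoc]
    exact Real.sq_sqrt (by positivity)
  have hlam : lam ≠ 0 := by
    intro h0
    apply h
    rw [← hlam_sq, h0, zero_pow two_ne_zero]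
  have hn : n ≠ 0 := by
    intro h0
    have : 0 < lam ^ 2 := by positivity
    nlinarith [sq_nonneg (ν 0)]
  clear_value lam n
  have horth : R * R.transpose = 1 := by
    ext i j
    fin_cases i <;> fin_cases j <;>
      simp [R, Matrix.mul_apply, Fin.sum_univ_four] <;> field_simp <;> grind
  have hdet : R.det = 1 := by
    simp [R, Matrix.det_succ_row_zero, Fin.sum_univ_succ, Fin.succAbove]
    field_simp
    grind
  have hcomm : R * (n • I0) = Omega ν * R := by
    ext i j
    fin_cases i <;> fin_cases j <;>
      simp [R, I0, Omega, Matrix.mul_apply, Fin.sum_univ_four] <;> field_simp <;> grind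
  refine ⟨Matrix.mem_specialOrthogonalGroup_iff.2
    ⟨(Matrix.mem_orthogonalGroup_iff _ _).2 horth, hdet⟩, ?_⟩
  rw [hcomm, Matrix.mul_nonsing_inv_cancel_right]
  simp [hdet]
end

section
/- Let ν ∈ ℝ³, a ∈ ℝ⁴, set A(y) = Ω_ν y, and define for f : ℝ⁴ → ℂ the magnetic translation (T_a f)(x) = e^{i⟨A(a), x⟩} f(x + a) and the Landau operator (H_ν f)(x) = −Δf(x) − 2i⟨Ω_ν x, ∇f(x)⟩ + ‖ν‖²‖x‖² f(x). Then for every twice continuously differentiable f : ℝ⁴ → ℂ and every x ∈ ℝ⁴, H_ν(T_a f)(x) = T_a(H_ν f)(x); that is, the Landau operator commutes with every magnetic translation. -/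
/-- Partial derivative in the `α`-th coordinate direction on `ℝ⁴`, for `ℂ`-valued functions. -/
noncomputable def pd (α : Fin 4) (g : (Fin 4 → ℝ) → ℂ) (x : Fin 4 → ℝ) : ℂ :=
  fderiv ℝ g x (Pi.single α 1)

/-- The Landau operator `H_ν f = −Δf − 2i⟨Ω_ν x, ∇f⟩ + ‖ν‖²‖x‖² f`. -/
noncomputable def Landau (ν : Fin 3 → ℝ) (f : (Fin 4 → ℝ) → ℂ) (x : Fin 4 → ℝ) : ℂ :=
  -(∑ α : Fin 4, pd α (pd α f) x)
    - 2 * Complex.I * ∑ α : Fin 4, ((Omega ν).mulVec x α : ℂ) * pd α f x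
    + (((ν 0 ^ 2 + ν 1 ^ 2 + ν 2 ^ 2) * ∑ α : Fin 4, (x α) ^ 2 : ℝ) : ℂ) * f x

/-- The magnetic translation `(T_a f)(x) = e^{i⟨A(a),x⟩} f(x+a)`, where `A(a) = Ω_ν a`. -/
noncomputable def Tmag (ν : Fin 3 → ℝ) (a : Fin 4 → ℝ) (f : (Fin 4 → ℝ) → ℂ)
    (x : Fin 4 → ℝ) : ℂ :=
  Complex.exp (Complex.I * ((∑ α : Fin 4, (Omega ν).mulVec a α * x α : ℝ) : ℂ)) * f (x + a)

/-- A partial derivative of `T_a f` is the magnetic translate of `i A(a)_α f + ∂_α f`. -/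
theorem pd_Tmag (ν : Fin 3 → ℝ) (a : Fin 4 → ℝ) {f : (Fin 4 → ℝ) → ℂ}
    (hf : Differentiable ℝ f) (α : Fin 4) :
    pd α (Tmag ν a f) =
      Tmag ν a (fun y => Complex.I * ((Omega ν).mulVec a α : ℂ) * f y + pd α f y) := by
  funext x
  have hsum : HasFDerivAt (fun y : Fin 4 → ℝ => ∑ β, (Omega ν).mulVec a β * y β)
      (∑ β, (Omega ν).mulVec a β • ContinuousLinearMap.proj (R := ℝ) (φ := fun _ => ℝ) β) x :=
    HasFDerivAt.fun_sum fun β _ => (hasFDerivAt_apply β x).const_mul _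
  have hphase := ((Complex.ofRealCLM.hasFDerivAt.comp x hsum).const_mul Complex.I).cexp
  have hshift : HasFDerivAt (fun y => f (y + a)) (fderiv ℝ f (x + a)) x :=
    (hasFDerivAt_comp_add_right a).2 (hf (x + a)).hasFDerivAt
  have hderiv : HasFDerivAt (Tmag ν a f) _ x := hphase.mul hshift
  rw [pd, hderiv.fderiv]
  simp [Tmag, pd, Pi.single_apply]
  ring

/-- Partial derivatives of a `C²` function are differentiable. -/
theorem ContDiff.differentiable_pd {f : (Fin 4 → ℝ) → ℂ} (hf : ContDiff ℝ 2 f) (α : Fin 4) :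
    Differentiable ℝ (pd α f) :=
  ((hf.fderiv_right (m := 1) (by norm_num)).clm_apply contDiff_const).differentiable
    (by norm_num)

/-- The partial derivative of `c f + g`. -/
theorem pd_const_mul_add {f g : (Fin 4 → ℝ) → ℂ} (hf : Differentiable ℝ f)
    (hg : Differentiable ℝ g) (c : ℂ) (α : Fin 4) (x : Fin 4 → ℝ) :
    pd α (fun y => c * f y + g y) x = c * pd α f x + pd α g x := by
  have h : HasFDerivAt (fun y => c * f y + g y) _ x :=
    ((hf x).hasFDerivAt.const_mul c).add (hg x).hasFDerivAt
  simp [pd, h.fderiv]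

/-- The Landau operator commutes with every magnetic translation:
`H_ν(T_a f) = T_a(H_ν f)`. -/
theorem landau_comm_Tmag (ν : Fin 3 → ℝ) (a : Fin 4 → ℝ) (f : (Fin 4 → ℝ) → ℂ)
    (hf : ContDiff ℝ 2 f) (x : Fin 4 → ℝ) :
    Landau ν (Tmag ν a f) x = Tmag ν a (Landau ν f) x := by
  have hd : Differentiable ℝ f := hf.differentiable (by norm_num)
  have hpd := hf.differentiable_pd
  have hcomb (c : ℂ) (α : Fin 4) : Differentiable ℝ (fun y => c * f y + pd α f y) :=
    (hd.const_mul c).add (hpd α)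
  simp only [Landau, pd_Tmag ν a hd, pd_Tmag ν a (hcomb _ _)]
  simp only [Tmag, Landau, pd_const_mul_add hd (hpd _)]
  simp only [Fin.sum_univ_four, Omega, Matrix.mulVec, dotProduct, Matrix.of_apply,
    Matrix.cons_val, Pi.add_apply]
  push_cast
  generalize Complex.exp _ = e
  ring_nf
  simp only [Complex.I_sq]
  ring
end
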